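/- For nullspace consistent tensor product SBP operators in three dimensions, the kernel of the discrete divergence equals the orthogonal direct sum of the image of the discrete curl and the span of (osc₂₃,0,0), (0,osc₁₃,0), (0,0,osc₁₂); in particular dim ker div = 2N₁N₂N₃ + 1 and dim im curl = 2N₁N₂N₃ - 2. -/

import Mathlib

open Matrix Kronecker

/-- Grid functions on a three-dimensional tensor product grid. -/
abbrev GridFun3 (N₁ N₂ N₃ : ℕ) := Fin N₁ × Fin N₂ × Fin N₃ → ℝ

lemma sbp1 {n : ℕ} (hn : 1 ≤ n) (D M : Matrix (Fin n) (Fin n) ℝ) (hM : M.PosDef)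
    (hD : LinearMap.ker D.mulVecLin = Submodule.span ℝ {(fun _ => 1 : Fin n → ℝ)})
    (osc : Fin n → ℝ)
    (hosc : LinearMap.ker (M⁻¹ * Dᵀ * M).mulVecLin = Submodule.span ℝ {osc}) :
    osc ≠ 0 ∧ Dᵀ *ᵥ (M *ᵥ osc) = 0 ∧ D *ᵥ (fun _ => 1) = 0 ∧
    ∃ (H : Matrix (Fin n) (Fin n) ℝ) (φ ψ : Fin n → ℝ),
      D * H + vecMulVec osc φ = 1 ∧ H * D + vecMulVec (fun _ => 1) ψ = 1 ∧
      vecMulVec osc φ * D = 0 ∧ D * vecMulVec (fun _ => 1) ψ = 0 ∧ φ ⬝ᵥ osc = 1 := by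
  have hdet : IsUnit M.det := hM.det_pos.ne'.isUnit
  have h1 : (fun _ => 1 : Fin n → ℝ) ≠ 0 := by
    intro h
    have := congrFun h ⟨0, hn⟩
    simp at this
  have hD1 : D *ᵥ (fun _ => 1) = 0 := by
    have : (fun _ => 1 : Fin n → ℝ) ∈ LinearMap.ker D.mulVecLin := by
      rw [hD]; exact Submodule.mem_span_singleton_self _
    simpa using this
  have hrD : D.rank + 1 = n := by
    have := D.mulVecLin.finrank_range_add_finrank_ker
    rw [hD, finrank_span_singleton h1] at this
    simpa [Matrix.rank] using this
  have hinv : IsUnit (M⁻¹).det := by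
    rw [Matrix.det_nonsing_inv]
    simpa using hdet
  have hrk : (M⁻¹ * Dᵀ * M).rank = D.rank := by
    rw [Matrix.rank_mul_eq_left_of_isUnit_det _ _ hdet,
      Matrix.rank_mul_eq_right_of_isUnit_det _ _ hinv, Matrix.rank_transpose]
  have ho : osc ≠ 0 := by
    rintro rfl
    have := (M⁻¹ * Dᵀ * M).mulVecLin.finrank_range_add_finrank_ker
    rw [hosc, Submodule.span_zero_singleton, finrank_bot] at this
    have h2 : (M⁻¹ * Dᵀ * M).rank = n := by simpa [Matrix.rank] using this
    omega
  have hDM : Dᵀ *ᵥ (M *ᵥ osc) = 0 := by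
    have : osc ∈ LinearMap.ker (M⁻¹ * Dᵀ * M).mulVecLin := by
      rw [hosc]; exact Submodule.mem_span_singleton_self _
    have h2 : (M⁻¹ * Dᵀ * M) *ᵥ osc = 0 := this
    have h3 : M *ᵥ ((M⁻¹ * Dᵀ * M) *ᵥ osc) = Dᵀ *ᵥ (M *ᵥ osc) := by
      rw [Matrix.mulVec_mulVec, Matrix.mulVec_mulVec, Matrix.mul_assoc,
        Matrix.mul_nonsing_inv_cancel_left _ _ hdet]
    rw [← h3, h2, Matrix.mulVec_zero]
  have hpos : 0 < osc ⬝ᵥ (M *ᵥ osc) := by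
    simpa using hM.dotProduct_mulVec_pos ho
  have hdis : ∀ (w : Fin n → ℝ) (c : ℝ), D *ᵥ w = c • osc → c = 0 := by
    intro w c h
    have h2 : (D *ᵥ w) ⬝ᵥ (M *ᵥ osc) = 0 := by
      rw [dotProduct_comm, Matrix.dotProduct_mulVec, ← Matrix.mulVec_transpose, hDM,
        zero_dotProduct]
    rw [h, smul_dotProduct, smul_eq_mul] at h2
    exact (mul_eq_zero.1 h2).resolve_right hpos.ne'
  let K : ((Fin n → ℝ) × ℝ) →ₗ[ℝ] (Fin n → ℝ) :=
    LinearMap.coprod D.mulVecLin (LinearMap.toSpanSingleton ℝ _ osc)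
  have hK : Function.Surjective K := by
    rw [← LinearMap.range_eq_top]
    apply Submodule.eq_top_of_finrank_eq
    have e : LinearMap.range K = LinearMap.range D.mulVecLin ⊔ Submodule.span ℝ {osc} := by
      rw [LinearMap.range_coprod, LinearMap.range_toSpanSingleton]
    have hinf : LinearMap.range D.mulVecLin ⊓ Submodule.span ℝ {osc} = ⊥ := by
      rw [eq_bot_iff]
      rintro x ⟨⟨w, hw⟩, hx⟩
      obtain ⟨c, rfl⟩ := Submodule.mem_span_singleton.1 hx
      have := hdis w c (by simpa using hw)
      simp [this]
    have := Submodule.finrank_sup_add_finrank_inf_eq (LinearMap.range D.mulVecLin)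
      (Submodule.span ℝ {osc})
    rw [hinf, finrank_span_singleton ho] at this
    rw [e]
    simp only [finrank_bot, add_zero] at this
    rw [this]
    simpa [Matrix.rank] using hrD
  obtain ⟨g, hg⟩ := LinearMap.exists_rightInverse_of_surjective K (LinearMap.range_eq_top.2 hK)
  have hg' : ∀ v, D *ᵥ (g v).1 + (g v).2 • osc = v := by
    intro v
    have := congrArg (fun f => f v) hg
    simpa [K] using this
  let H : Matrix (Fin n) (Fin n) ℝ := LinearMap.toMatrix' (LinearMap.fst ℝ _ _ ∘ₗ g)
  let φ : Fin n → ℝ := fun i => (g (Pi.single i 1)).2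
  have hH : ∀ v, H *ᵥ v = (g v).1 := by
    intro v
    simp only [H, LinearMap.toMatrix'_mulVec]
    rfl
  have hφ : ∀ v, φ ⬝ᵥ v = (g v).2 := by
    intro v
    have := LinearMap.pi_apply_eq_sum_univ (LinearMap.snd ℝ _ _ ∘ₗ g) v
    simp only [LinearMap.comp_apply, LinearMap.snd_apply, smul_eq_mul] at this
    rw [this]
    simp only [dotProduct, φ]
    refine Finset.sum_congr rfl fun i _ => ?_
    rw [mul_comm]
    congr 3
    ext j
    simp [Pi.single_apply, eq_comm]
  have e1 : ∀ v, D *ᵥ (H *ᵥ v) + (φ ⬝ᵥ v) • osc = v := by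
    intro v; rw [hH, hφ, hg']
  have hv : ∀ (a b v : Fin n → ℝ), vecMulVec a b *ᵥ v = (b ⬝ᵥ v) • a := by
    intro a b v
    ext i
    simp [Matrix.vecMulVec_mulVec]
    try ring
  have e2 : ∀ v, φ ⬝ᵥ (D *ᵥ v) = 0 := by
    intro v
    apply hdis (v - H *ᵥ (D *ᵥ v))
    rw [Matrix.mulVec_sub, sub_eq_iff_eq_add, add_comm]
    exact (e1 _).symm
  have e3 : ∀ v, D *ᵥ (v - H *ᵥ (D *ᵥ v)) = 0 := by
    intro v
    have := e1 (D *ᵥ v)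
    rw [e2, zero_smul, add_zero] at this
    rw [Matrix.mulVec_sub, this, sub_self]
  let ψ : Fin n → ℝ := fun i => (1 - H * D) ⟨0, hn⟩ i
  have e4 : ∀ v, v - H *ᵥ (D *ᵥ v) = (ψ ⬝ᵥ v) • (fun _ => 1) := by
    intro v
    have hm : v - H *ᵥ (D *ᵥ v) ∈ LinearMap.ker D.mulVecLin := by simpa using e3 v
    rw [hD] at hm
    obtain ⟨c, hc⟩ := Submodule.mem_span_singleton.1 hm
    rw [← hc]
    congr 1
    have h5 : ψ ⬝ᵥ v = ((1 - H * D) *ᵥ v) ⟨0, hn⟩ := rfl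
    rw [h5, Matrix.sub_mulVec, Matrix.one_mulVec, ← Matrix.mulVec_mulVec, ← hc]
    simp
  refine ⟨ho, hDM, hD1, H, φ, ψ, ?_, ?_, ?_, ?_, ?_⟩
  · apply Matrix.ext_of_mulVec_single
    intro i
    rw [Matrix.add_mulVec, hv, ← Matrix.mulVec_mulVec, e1, Matrix.one_mulVec]
  · apply Matrix.ext_of_mulVec_single
    intro i
    rw [Matrix.add_mulVec, hv, ← Matrix.mulVec_mulVec, ← e4, Matrix.one_mulVec]
    abel
  · apply Matrix.ext_of_mulVec_single
    intro i
    rw [← Matrix.mulVec_mulVec, hv, e2, Matrix.zero_mulVec, zero_smul]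
  · apply Matrix.ext_of_mulVec_single
    intro i
    rw [← Matrix.mulVec_mulVec, hv, Matrix.mulVec_smul, hD1, Matrix.zero_mulVec, smul_zero]
  · have h6 := e1 osc
    have h7 := hdis (H *ᵥ osc) (1 - φ ⬝ᵥ osc) (by
      rw [sub_smul, one_smul, eq_sub_iff_add_eq]; exact h6)
    linarith

lemma range_three {α : Type*} (a b c : α) : Set.range ![a, b, c] = {a, b, c} := by
  ext x
  simp [eq_comm]
  tauto

/-- Pure tensors. -/
def t3 {N₁ N₂ N₃ : ℕ} (a : Fin N₁ → ℝ) (b : Fin N₂ → ℝ) (c : Fin N₃ → ℝ) : GridFun3 N₁ N₂ N₃ :=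
  fun p => a p.1 * b p.2.1 * c p.2.2

lemma t3_dot {N₁ N₂ N₃ : ℕ} (a a' : Fin N₁ → ℝ) (b b' : Fin N₂ → ℝ) (c c' : Fin N₃ → ℝ) :
    t3 a b c ⬝ᵥ t3 a' b' c' = (a ⬝ᵥ a') * (b ⬝ᵥ b') * (c ⬝ᵥ c') := by
  simp only [dotProduct, t3, Fintype.sum_prod_type]
  rw [Finset.sum_mul_sum, Finset.sum_mul]
  simp only [Finset.sum_mul_sum]
  refine Finset.sum_congr rfl fun i _ => Finset.sum_congr rfl fun j _ =>
    Finset.sum_congr rfl fun k _ => by ring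

lemma k3_mulVec {N₁ N₂ N₃ : ℕ} (A : Matrix (Fin N₁) (Fin N₁) ℝ) (B : Matrix (Fin N₂) (Fin N₂) ℝ)
    (C : Matrix (Fin N₃) (Fin N₃) ℝ) (a : Fin N₁ → ℝ) (b : Fin N₂ → ℝ) (c : Fin N₃ → ℝ) :
    (A ⊗ₖ (B ⊗ₖ C)) *ᵥ t3 a b c = t3 (A *ᵥ a) (B *ᵥ b) (C *ᵥ c) := by
  ext ⟨i, j, k⟩
  have := t3_dot (A i) a (B j) b (C k) c
  simp only [t3, mulVec] at this ⊢
  rw [← this]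
  simp only [dotProduct, t3, Matrix.kroneckerMap_apply, mul_assoc]

lemma t3_ne {N₁ N₂ N₃ : ℕ} {a : Fin N₁ → ℝ} {b : Fin N₂ → ℝ} {c : Fin N₃ → ℝ}
    (ha : a ≠ 0) (hb : b ≠ 0) (hc : c ≠ 0) : t3 a b c ≠ 0 := by
  obtain ⟨i, hi⟩ := Function.ne_iff.1 ha
  obtain ⟨j, hj⟩ := Function.ne_iff.1 hb
  obtain ⟨k, hk⟩ := Function.ne_iff.1 hc
  exact Function.ne_iff.2 ⟨(i, j, k), mul_ne_zero (mul_ne_zero hi hj) hk⟩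

lemma k3_vecMulVec {N₁ N₂ N₃ : ℕ} (a a' : Fin N₁ → ℝ) (b b' : Fin N₂ → ℝ) (c c' : Fin N₃ → ℝ)
    (v : GridFun3 N₁ N₂ N₃) :
    (vecMulVec a a' ⊗ₖ (vecMulVec b b' ⊗ₖ vecMulVec c c')) *ᵥ v
      = (t3 a' b' c' ⬝ᵥ v) • t3 a b c := by
  ext ⟨i, j, k⟩
  simp only [mulVec, dotProduct, t3, Matrix.kroneckerMap_apply, vecMulVec_apply, Pi.smul_apply,
    smul_eq_mul, Finset.sum_mul]
  refine Finset.sum_congr rfl fun p _ => by ring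

lemma homotopy {V : Type*} [AddCommGroup V] (D₁ D₂ D₃ H₁ H₂ H₃ P₁ P₂ P₃ S₁ S₂ S₃ : V →+ V)
    (a₁ : ∀ x, D₁ (H₁ x) + P₁ x = x) (a₂ : ∀ x, D₂ (H₂ x) + P₂ x = x)
    (a₃ : ∀ x, D₃ (H₃ x) + P₃ x = x)
    (b₁ : ∀ x, H₁ (D₁ x) + S₁ x = x) (b₂ : ∀ x, H₂ (D₂ x) + S₂ x = x)
    (b₃ : ∀ x, H₃ (D₃ x) + S₃ x = x)
    (c₁ : ∀ x, P₁ (D₁ x) = 0) (c₂ : ∀ x, P₂ (D₂ x) = 0)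
    (d₁ : ∀ x, D₁ (S₁ x) = 0) (d₂ : ∀ x, D₂ (S₂ x) = 0)
    (D₂S₁ : ∀ x, D₂ (S₁ x) = S₁ (D₂ x)) (D₃S₁ : ∀ x, D₃ (S₁ x) = S₁ (D₃ x))
    (D₃S₂ : ∀ x, D₃ (S₂ x) = S₂ (D₃ x))
    (D₂H₁ : ∀ x, D₂ (H₁ x) = H₁ (D₂ x)) (D₃H₁ : ∀ x, D₃ (H₁ x) = H₁ (D₃ x))
    (D₃H₂ : ∀ x, D₃ (H₂ x) = H₂ (D₃ x))
    (D₁H₂ : ∀ x, D₁ (H₂ x) = H₂ (D₁ x)) (D₁H₃ : ∀ x, D₁ (H₃ x) = H₃ (D₁ x))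
    (D₂H₃ : ∀ x, D₂ (H₃ x) = H₃ (D₂ x))
    (D₂P₁ : ∀ x, D₂ (P₁ x) = P₁ (D₂ x)) (D₃P₁ : ∀ x, D₃ (P₁ x) = P₁ (D₃ x))
    (D₃P₂ : ∀ x, D₃ (P₂ x) = P₂ (D₃ x)) (D₁P₂ : ∀ x, D₁ (P₂ x) = P₂ (D₁ x))
    (u₁ u₂ u₃ : V) (hu : D₁ u₁ + D₂ u₂ + D₃ u₃ = 0) :
    D₂ (S₁ (H₂ u₁) - H₁ u₂) - D₃ (H₁ u₃ - S₁ (P₂ (H₃ u₁))) + S₁ (P₂ (P₃ u₁)) = u₁ ∧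
    D₃ (P₁ (S₂ (H₃ u₂)) - P₁ (H₂ u₃)) - D₁ (S₁ (H₂ u₁) - H₁ u₂) + P₁ (S₂ (P₃ u₂)) = u₂ ∧
    D₁ (H₁ u₃ - S₁ (P₂ (H₃ u₁))) - D₂ (P₁ (S₂ (H₃ u₂)) - P₁ (H₂ u₃)) + P₁ (P₂ (S₃ u₃)) = u₃ := by
  have a₁' : ∀ x, D₁ (H₁ x) = x - P₁ x := fun x => eq_sub_of_add_eq (a₁ x)
  have a₂' : ∀ x, D₂ (H₂ x) = x - P₂ x := fun x => eq_sub_of_add_eq (a₂ x)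
  have a₃' : ∀ x, D₃ (H₃ x) = x - P₃ x := fun x => eq_sub_of_add_eq (a₃ x)
  have b₁' : ∀ x, H₁ (D₁ x) = x - S₁ x := fun x => eq_sub_of_add_eq (b₁ x)
  have b₂' : ∀ x, H₂ (D₂ x) = x - S₂ x := fun x => eq_sub_of_add_eq (b₂ x)
  have b₃' : ∀ x, S₃ x = x - H₃ (D₃ x) := fun x => eq_sub_of_add_eq' (b₃ x)
  have hu' : D₃ u₃ = - D₁ u₁ - D₂ u₂ := by
    rw [eq_comm, ← sub_eq_zero, ← neg_eq_zero, ← hu]; abel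
  have z : P₁ (P₂ (H₃ (D₁ u₁))) = 0 := by rw [← D₁H₃, ← D₁P₂, c₁]
  have z' : P₁ (H₂ (D₁ u₁)) = 0 := by rw [← D₁H₂, c₁]
  have z'' : P₁ (P₂ (H₃ (D₂ u₂))) = 0 := by rw [← D₂H₃, c₂, map_zero]
  refine ⟨?_, ?_, ?_⟩
  · simp only [map_sub, map_neg, D₂S₁, D₃S₁, D₂H₁, D₃H₁, D₃P₂, a₂', a₃', hu', b₁']
    abel
  · simp only [map_sub, map_neg, D₃P₁, D₃S₂, D₃H₂, a₃', hu', b₂', z', d₁, a₁']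
    abel
  · simp only [map_sub, map_neg, d₁, a₁', D₂P₁, d₂, a₂', b₃', hu', z, z'', map_zero]
    abel

/-- For nullspace consistent tensor product SBP operators in three dimensions, the kernel of
the discrete divergence equals the `M`-orthogonal direct sum of the image of the discrete curl
and the span of `(osc₂₃,0,0)`, `(0,osc₁₃,0)`, `(0,0,osc₁₂)`; in particular
`dim ker div = 2N₁N₂N₃ + 1` and `dim im curl = 2N₁N₂N₃ - 2`. -/
theorem ker_div_eq_im_curl_oplus_osc_3D (N₁ N₂ N₃ : ℕ)
    (hN₁ : 1 ≤ N₁) (hN₂ : 1 ≤ N₂) (hN₃ : 1 ≤ N₃)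
    (Dx Mx : Matrix (Fin N₁) (Fin N₁) ℝ) (Dy My : Matrix (Fin N₂) (Fin N₂) ℝ)
    (Dz Mz : Matrix (Fin N₃) (Fin N₃) ℝ)
    (hMx : Mx.PosDef) (hMxsym : Mx.IsSymm) (hMy : My.PosDef) (hMysym : My.IsSymm)
    (hMz : Mz.PosDef) (hMzsym : Mz.IsSymm)
    (hDx : LinearMap.ker Dx.mulVecLin = Submodule.span ℝ {(fun _ => 1 : Fin N₁ → ℝ)})
    (hDy : LinearMap.ker Dy.mulVecLin = Submodule.span ℝ {(fun _ => 1 : Fin N₂ → ℝ)})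
    (hDz : LinearMap.ker Dz.mulVecLin = Submodule.span ℝ {(fun _ => 1 : Fin N₃ → ℝ)})
    (oscx : Fin N₁ → ℝ) (oscy : Fin N₂ → ℝ) (oscz : Fin N₃ → ℝ)
    (hoscx : LinearMap.ker (Mx⁻¹ * Dxᵀ * Mx).mulVecLin = Submodule.span ℝ {oscx})
    (hoscy : LinearMap.ker (My⁻¹ * Dyᵀ * My).mulVecLin = Submodule.span ℝ {oscy})
    (hoscz : LinearMap.ker (Mz⁻¹ * Dzᵀ * Mz).mulVecLin = Submodule.span ℝ {oscz})
    (D₁ D₂ D₃ : Matrix (Fin N₁ × Fin N₂ × Fin N₃) (Fin N₁ × Fin N₂ × Fin N₃) ℝ)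
    (hD₁ : D₁ = Dx ⊗ₖ ((1 : Matrix (Fin N₂) (Fin N₂) ℝ) ⊗ₖ (1 : Matrix (Fin N₃) (Fin N₃) ℝ)))
    (hD₂ : D₂ = (1 : Matrix (Fin N₁) (Fin N₁) ℝ) ⊗ₖ (Dy ⊗ₖ (1 : Matrix (Fin N₃) (Fin N₃) ℝ)))
    (hD₃ : D₃ = (1 : Matrix (Fin N₁) (Fin N₁) ℝ) ⊗ₖ ((1 : Matrix (Fin N₂) (Fin N₂) ℝ) ⊗ₖ Dz))
    (M : Matrix (Fin N₁ × Fin N₂ × Fin N₃) (Fin N₁ × Fin N₂ × Fin N₃) ℝ)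
    (hM : M = Mx ⊗ₖ (My ⊗ₖ Mz))
    (P₁ P₂ P₃ : GridFun3 N₁ N₂ N₃ × GridFun3 N₁ N₂ N₃ × GridFun3 N₁ N₂ N₃ →ₗ[ℝ] GridFun3 N₁ N₂ N₃)
    (hP₁ : P₁ = LinearMap.fst ℝ _ _)
    (hP₂ : P₂ = LinearMap.fst ℝ _ _ ∘ₗ LinearMap.snd ℝ (GridFun3 N₁ N₂ N₃) _)
    (hP₃ : P₃ = LinearMap.snd ℝ (GridFun3 N₁ N₂ N₃) _ ∘ₗ LinearMap.snd ℝ (GridFun3 N₁ N₂ N₃) _)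
    (curl : GridFun3 N₁ N₂ N₃ × GridFun3 N₁ N₂ N₃ × GridFun3 N₁ N₂ N₃ →ₗ[ℝ]
      GridFun3 N₁ N₂ N₃ × GridFun3 N₁ N₂ N₃ × GridFun3 N₁ N₂ N₃)
    (hcurl : curl = LinearMap.prod
      (D₂.mulVecLin ∘ₗ P₃ - D₃.mulVecLin ∘ₗ P₂)
      (LinearMap.prod (D₃.mulVecLin ∘ₗ P₁ - D₁.mulVecLin ∘ₗ P₃)
        (D₁.mulVecLin ∘ₗ P₂ - D₂.mulVecLin ∘ₗ P₁)))
    (div : GridFun3 N₁ N₂ N₃ × GridFun3 N₁ N₂ N₃ × GridFun3 N₁ N₂ N₃ →ₗ[ℝ] GridFun3 N₁ N₂ N₃)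
    (hdiv : div = D₁.mulVecLin ∘ₗ P₁ + D₂.mulVecLin ∘ₗ P₂ + D₃.mulVecLin ∘ₗ P₃)
    (osc₂₃ osc₁₃ osc₁₂ : GridFun3 N₁ N₂ N₃)
    (hosc₂₃ : osc₂₃ = fun p => oscy p.2.1 * oscz p.2.2)
    (hosc₁₃ : osc₁₃ = fun p => oscx p.1 * oscz p.2.2)
    (hosc₁₂ : osc₁₂ = fun p => oscx p.1 * oscy p.2.1)
    (O : Submodule ℝ (GridFun3 N₁ N₂ N₃ × GridFun3 N₁ N₂ N₃ × GridFun3 N₁ N₂ N₃))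
    (hO : O = Submodule.span ℝ {(osc₂₃, 0, 0), (0, osc₁₃, 0), (0, 0, osc₁₂)}) :
    LinearMap.ker div = LinearMap.range curl ⊔ O ∧
      Disjoint (LinearMap.range curl) O ∧
      (∀ u ∈ LinearMap.range curl, ∀ w ∈ O,
        u.1 ⬝ᵥ M.mulVec w.1 + u.2.1 ⬝ᵥ M.mulVec w.2.1 + u.2.2 ⬝ᵥ M.mulVec w.2.2 = 0) ∧
      Module.finrank ℝ ↥(LinearMap.ker div) = 2 * (N₁ * N₂ * N₃) + 1 ∧
      Module.finrank ℝ ↥(LinearMap.range curl) = 2 * (N₁ * N₂ * N₃) - 2 := by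
  obtain ⟨ox, ax, ux, Hx, fx, gx, x1, x2, x3, x4, x5⟩ := sbp1 hN₁ Dx Mx hMx hDx oscx hoscx
  obtain ⟨oy, ay, uy, Hy, fy, gy, y1, y2, y3, y4, y5⟩ := sbp1 hN₂ Dy My hMy hDy oscy hoscy
  obtain ⟨oz, az, uz, Hz, fz, gz, z1, z2, z3, z4, z5⟩ := sbp1 hN₃ Dz Mz hMz hDz oscz hoscz
  have one_ne : ∀ {n : ℕ}, 1 ≤ n → (fun _ => 1 : Fin n → ℝ) ≠ 0 := by
    intro n hn h
    have := congrFun h ⟨0, hn⟩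
    simp at this
  have t₂₃ : osc₂₃ = t3 (fun _ => 1) oscy oscz := by rw [hosc₂₃]; ext p; simp [t3]
  have t₁₃ : osc₁₃ = t3 oscx (fun _ => 1) oscz := by rw [hosc₁₃]; ext p; simp [t3]
  have t₁₂ : osc₁₂ = t3 oscx oscy (fun _ => 1) := by rw [hosc₁₂]; ext p; simp [t3]
  have n₂₃ : osc₂₃ ≠ 0 := t₂₃ ▸ t3_ne (one_ne hN₁) oy oz
  have n₁₃ : osc₁₃ ≠ 0 := t₁₃ ▸ t3_ne ox (one_ne hN₂) oz
  have n₁₂ : osc₁₂ ≠ 0 := t₁₂ ▸ t3_ne ox oy (one_ne hN₃)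
  have cz : ∀ w, curl w = (D₂ *ᵥ w.2.2 - D₃ *ᵥ w.2.1, D₃ *ᵥ w.1 - D₁ *ᵥ w.2.2,
      D₁ *ᵥ w.2.1 - D₂ *ᵥ w.1) := by
    intro w; rw [hcurl, hP₁, hP₂, hP₃]; rfl
  have dz : ∀ w, div w = D₁ *ᵥ w.1 + D₂ *ᵥ w.2.1 + D₃ *ᵥ w.2.2 := by
    intro w; rw [hdiv, hP₁, hP₂, hP₃]; rfl
  have memO : ∀ w, w ∈ O ↔ ∃ a b c : ℝ, w = (a • osc₂₃, b • osc₁₃, c • osc₁₂) := by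
    intro w
    rw [hO, Submodule.mem_span_triple]
    constructor
    · rintro ⟨a, b, c, rfl⟩
      exact ⟨a, b, c, by simp⟩
    · rintro ⟨a, b, c, rfl⟩
      exact ⟨a, b, c, by simp⟩
  -- the auxiliary operators
  let K := fun (A : Matrix (Fin N₁) (Fin N₁) ℝ) (B : Matrix (Fin N₂) (Fin N₂) ℝ)
    (C : Matrix (Fin N₃) (Fin N₃) ℝ) => A ⊗ₖ (B ⊗ₖ C)
  have Kmul : ∀ A B C A' B' C' v, K A B C *ᵥ (K A' B' C' *ᵥ v) = K (A * A') (B * B') (C * C') *ᵥ v := by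
    intro A B C A' B' C' v
    simp only [K, Matrix.mulVec_mulVec, Matrix.mul_kronecker_mul]
  have K1 : K 1 1 1 = 1 := by simp [K]
  have Ka : ∀ A A' B C v, K A B C *ᵥ v + K A' B C *ᵥ v = K (A + A') B C *ᵥ v := by
    intro A A' B C v
    simp only [K, Matrix.add_kronecker, Matrix.add_mulVec]
  have Kb : ∀ A B B' C v, K A B C *ᵥ v + K A B' C *ᵥ v = K A (B + B') C *ᵥ v := by
    intro A A' B C v
    simp only [K, Matrix.add_kronecker, Matrix.kronecker_add, Matrix.add_mulVec]
  have Kc : ∀ A B C C' v, K A B C *ᵥ v + K A B C' *ᵥ v = K A B (C + C') *ᵥ v := by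
    intro A A' B C v
    simp only [K, Matrix.kronecker_add, Matrix.add_mulVec]
  have K0a : ∀ B C, K 0 B C = 0 := by intro B C; simp [K]
  have K0b : ∀ B C, K B 0 C = 0 := by intro B C; simp [K]
  have K0c : ∀ B C, K B C 0 = 0 := by intro B C; simp [K]
  have Kt : ∀ A B C a b c, K A B C *ᵥ t3 a b c = t3 (A *ᵥ a) (B *ᵥ b) (C *ᵥ c) :=
    fun A B C a b c => k3_mulVec A B C a b c
  have hD₁' : D₁ = K Dx 1 1 := hD₁
  have hD₂' : D₂ = K 1 Dy 1 := hD₂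
  have hD₃' : D₃ = K 1 1 Dz := hD₃
  let Px := vecMulVec oscx fx
  let Py := vecMulVec oscy fy
  let Pz := vecMulVec oscz fz
  let Sx : Matrix (Fin N₁) (Fin N₁) ℝ := vecMulVec (fun _ => 1) gx
  let Sy : Matrix (Fin N₂) (Fin N₂) ℝ := vecMulVec (fun _ => 1) gy
  let Sz : Matrix (Fin N₃) (Fin N₃) ℝ := vecMulVec (fun _ => 1) gz
  let T := fun A : Matrix (Fin N₁ × Fin N₂ × Fin N₃) (Fin N₁ × Fin N₂ × Fin N₃) ℝ =>
    A.mulVecLin.toAddMonoidHom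
  have tz : ∀ {b : Fin N₂ → ℝ} {c : Fin N₃ → ℝ}, t3 (0 : Fin N₁ → ℝ) b c = 0 := by
    intro b c; ext p; simp [t3]
  have tz' : ∀ {b : Fin N₁ → ℝ} {c : Fin N₃ → ℝ}, t3 b (0 : Fin N₂ → ℝ) c = 0 := by
    intro b c; ext p; simp [t3]
  have tz'' : ∀ {b : Fin N₁ → ℝ} {c : Fin N₂ → ℝ}, t3 b c (0 : Fin N₃ → ℝ) = 0 := by
    intro b c; ext p; simp [t3]
  -- curl images lie in the kernel
  have hle1 : LinearMap.range curl ≤ LinearMap.ker div := by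
    rintro _ ⟨w, rfl⟩
    rw [LinearMap.mem_ker, dz, cz]
    simp only [hD₁', hD₂', hD₃', Matrix.mulVec_sub, Kmul, mul_one, one_mul]
    abel
  have hle2 : O ≤ LinearMap.ker div := by
    intro w hw
    obtain ⟨a, b, c, rfl⟩ := (memO w).1 hw
    rw [LinearMap.mem_ker, dz]
    simp only [hD₁', hD₂', hD₃', Matrix.mulVec_smul, t₂₃, t₁₃, t₁₂, Kt, ux, uy, uz, tz, tz', tz'',
      smul_zero, add_zero]
  have hker : LinearMap.ker div = LinearMap.range curl ⊔ O := by
    apply le_antisymm _ (sup_le hle1 hle2)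
    rintro ⟨u₁, u₂, u₃⟩ hu
    rw [LinearMap.mem_ker, dz] at hu
    obtain ⟨q1, q2, q3⟩ := homotopy (T (K Dx 1 1)) (T (K 1 Dy 1)) (T (K 1 1 Dz))
      (T (K Hx 1 1)) (T (K 1 Hy 1)) (T (K 1 1 Hz))
      (T (K Px 1 1)) (T (K 1 Py 1)) (T (K 1 1 Pz))
      (T (K Sx 1 1)) (T (K 1 Sy 1)) (T (K 1 1 Sz))
      (fun x => by
        change K Dx 1 1 *ᵥ (K Hx 1 1 *ᵥ x) + K Px 1 1 *ᵥ x = x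
        simp only [Kmul, mul_one, Ka, Px, x1, K1, Matrix.one_mulVec])
      (fun x => by
        change K 1 Dy 1 *ᵥ (K 1 Hy 1 *ᵥ x) + K 1 Py 1 *ᵥ x = x
        simp only [Kmul, mul_one, Kb, Py, y1, K1, Matrix.one_mulVec])
      (fun x => by
        change K 1 1 Dz *ᵥ (K 1 1 Hz *ᵥ x) + K 1 1 Pz *ᵥ x = x
        simp only [Kmul, mul_one, Kc, Pz, z1, K1, Matrix.one_mulVec])
      (fun x => by
        change K Hx 1 1 *ᵥ (K Dx 1 1 *ᵥ x) + K Sx 1 1 *ᵥ x = x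
        simp only [Kmul, mul_one, Ka, Sx, x2, K1, Matrix.one_mulVec])
      (fun x => by
        change K 1 Hy 1 *ᵥ (K 1 Dy 1 *ᵥ x) + K 1 Sy 1 *ᵥ x = x
        simp only [Kmul, mul_one, Kb, Sy, y2, K1, Matrix.one_mulVec])
      (fun x => by
        change K 1 1 Hz *ᵥ (K 1 1 Dz *ᵥ x) + K 1 1 Sz *ᵥ x = x
        simp only [Kmul, mul_one, Kc, Sz, z2, K1, Matrix.one_mulVec])
      (fun x => by
        change K Px 1 1 *ᵥ (K Dx 1 1 *ᵥ x) = 0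
        simp only [Kmul, Px, x3, K0a, Matrix.zero_mulVec])
      (fun x => by
        change K 1 Py 1 *ᵥ (K 1 Dy 1 *ᵥ x) = 0
        simp only [Kmul, Py, y3, K0b, Matrix.zero_mulVec])
      (fun x => by
        change K Dx 1 1 *ᵥ (K Sx 1 1 *ᵥ x) = 0
        simp only [Kmul, Sx, x4, K0a, Matrix.zero_mulVec])
      (fun x => by
        change K 1 Dy 1 *ᵥ (K 1 Sy 1 *ᵥ x) = 0
        simp only [Kmul, Sy, y4, K0b, Matrix.zero_mulVec])
      (fun x => (Kmul _ _ _ _ _ _ x).trans (by simp only [mul_one, one_mul]; symm; refine (Kmul _ _ _ _ _ _ x).trans (by simp only [mul_one, one_mul])))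
      (fun x => (Kmul _ _ _ _ _ _ x).trans (by simp only [mul_one, one_mul]; symm; refine (Kmul _ _ _ _ _ _ x).trans (by simp only [mul_one, one_mul])))
      (fun x => (Kmul _ _ _ _ _ _ x).trans (by simp only [mul_one, one_mul]; symm; refine (Kmul _ _ _ _ _ _ x).trans (by simp only [mul_one, one_mul])))
      (fun x => (Kmul _ _ _ _ _ _ x).trans (by simp only [mul_one, one_mul]; symm; refine (Kmul _ _ _ _ _ _ x).trans (by simp only [mul_one, one_mul])))
      (fun x => (Kmul _ _ _ _ _ _ x).trans (by simp only [mul_one, one_mul]; symm; refine (Kmul _ _ _ _ _ _ x).trans (by simp only [mul_one, one_mul])))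
      (fun x => (Kmul _ _ _ _ _ _ x).trans (by simp only [mul_one, one_mul]; symm; refine (Kmul _ _ _ _ _ _ x).trans (by simp only [mul_one, one_mul])))
      (fun x => (Kmul _ _ _ _ _ _ x).trans (by simp only [mul_one, one_mul]; symm; refine (Kmul _ _ _ _ _ _ x).trans (by simp only [mul_one, one_mul])))
      (fun x => (Kmul _ _ _ _ _ _ x).trans (by simp only [mul_one, one_mul]; symm; refine (Kmul _ _ _ _ _ _ x).trans (by simp only [mul_one, one_mul])))
      (fun x => (Kmul _ _ _ _ _ _ x).trans (by simp only [mul_one, one_mul]; symm; refine (Kmul _ _ _ _ _ _ x).trans (by simp only [mul_one, one_mul])))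
      (fun x => (Kmul _ _ _ _ _ _ x).trans (by simp only [mul_one, one_mul]; symm; refine (Kmul _ _ _ _ _ _ x).trans (by simp only [mul_one, one_mul])))
      (fun x => (Kmul _ _ _ _ _ _ x).trans (by simp only [mul_one, one_mul]; symm; refine (Kmul _ _ _ _ _ _ x).trans (by simp only [mul_one, one_mul])))
      (fun x => (Kmul _ _ _ _ _ _ x).trans (by simp only [mul_one, one_mul]; symm; refine (Kmul _ _ _ _ _ _ x).trans (by simp only [mul_one, one_mul])))
      (fun x => (Kmul _ _ _ _ _ _ x).trans (by simp only [mul_one, one_mul]; symm; refine (Kmul _ _ _ _ _ _ x).trans (by simp only [mul_one, one_mul])))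
      u₁ u₂ u₃ (by rw [hD₁', hD₂', hD₃'] at hu; exact hu)
    have r1 : T (K Sx 1 1) (T (K 1 Py 1) (T (K 1 1 Pz) u₁))
        = (t3 gx fy fz ⬝ᵥ u₁) • osc₂₃ := by
      change K Sx 1 1 *ᵥ (K 1 Py 1 *ᵥ (K 1 1 Pz *ᵥ u₁)) = _
      simp only [Kmul, mul_one, one_mul, t₂₃]
      exact k3_vecMulVec _ _ _ _ _ _ _
    have r2 : T (K Px 1 1) (T (K 1 Sy 1) (T (K 1 1 Pz) u₂))
        = (t3 fx gy fz ⬝ᵥ u₂) • osc₁₃ := by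
      change K Px 1 1 *ᵥ (K 1 Sy 1 *ᵥ (K 1 1 Pz *ᵥ u₂)) = _
      simp only [Kmul, mul_one, one_mul, t₁₃]
      exact k3_vecMulVec _ _ _ _ _ _ _
    have r3 : T (K Px 1 1) (T (K 1 Py 1) (T (K 1 1 Sz) u₃))
        = (t3 fx fy gz ⬝ᵥ u₃) • osc₁₂ := by
      change K Px 1 1 *ᵥ (K 1 Py 1 *ᵥ (K 1 1 Sz *ᵥ u₃)) = _
      simp only [Kmul, mul_one, one_mul, t₁₂]
      exact k3_vecMulVec _ _ _ _ _ _ _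
    rw [r1] at q1
    rw [r2] at q2
    rw [r3] at q3
    have key : ∀ (w₁ w₂ w₃ : GridFun3 N₁ N₂ N₃) (a b c : ℝ),
        K 1 Dy 1 *ᵥ w₃ - K 1 1 Dz *ᵥ w₂ + a • osc₂₃ = u₁ →
        K 1 1 Dz *ᵥ w₁ - K Dx 1 1 *ᵥ w₃ + b • osc₁₃ = u₂ →
        K Dx 1 1 *ᵥ w₂ - K 1 Dy 1 *ᵥ w₁ + c • osc₁₂ = u₃ →
        (u₁, u₂, u₃) ∈ LinearMap.range curl ⊔ O := by
      intro w₁ w₂ w₃ a b c h1 h2 h3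
      refine Submodule.mem_sup.2 ⟨curl (w₁, w₂, w₃), ⟨_, rfl⟩,
        (a • osc₂₃, b • osc₁₃, c • osc₁₂), (memO _).2 ⟨a, b, c, rfl⟩, ?_⟩
      rw [cz, hD₁', hD₂', hD₃']
      exact Prod.ext h1 (Prod.ext h2 h3)
    exact key _ _ _ _ _ _ q1 q2 q3
  have hsym : Mᵀ = M := by
    rw [hM, ← Matrix.kroneckerMap_transpose, ← Matrix.kroneckerMap_transpose, hMxsym.eq, hMysym.eq,
      hMzsym.eq]
  have hMpd : M.PosDef := by rw [hM]; exact hMx.kronecker (hMy.kronecker hMz)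
  have hadj : ∀ (A : Matrix (Fin N₁ × Fin N₂ × Fin N₃) (Fin N₁ × Fin N₂ × Fin N₃) ℝ) v x,
      Aᵀ *ᵥ x = 0 → (A *ᵥ v) ⬝ᵥ x = 0 := by
    intro A v x h
    rw [dotProduct_comm, Matrix.dotProduct_mulVec, ← Matrix.mulVec_transpose, h, zero_dotProduct]
  have hM' : M = K Mx My Mz := hM
  have KT : ∀ A B C, (K A B C)ᵀ = K Aᵀ Bᵀ Cᵀ := by
    intro A B C
    simp only [K, ← Matrix.kroneckerMap_transpose]
  have horth : ∀ u ∈ LinearMap.range curl, ∀ w ∈ O,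
        u.1 ⬝ᵥ M.mulVec w.1 + u.2.1 ⬝ᵥ M.mulVec w.2.1 + u.2.2 ⬝ᵥ M.mulVec w.2.2 = 0 := by
    rintro _ ⟨v, rfl⟩ w hw
    obtain ⟨a, b, c, rfl⟩ := (memO w).1 hw
    have s1 : D₁ᵀ *ᵥ (M *ᵥ osc₁₃) = 0 := by
      rw [hD₁', hM', KT, t₁₃, Kt, Kt, ax, tz]
    have s2 : D₁ᵀ *ᵥ (M *ᵥ osc₁₂) = 0 := by
      rw [hD₁', hM', KT, t₁₂, Kt, Kt, ax, tz]
    have s3 : D₂ᵀ *ᵥ (M *ᵥ osc₂₃) = 0 := by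
      rw [hD₂', hM', KT, t₂₃, Kt, Kt, ay, tz']
    have s4 : D₂ᵀ *ᵥ (M *ᵥ osc₁₂) = 0 := by
      rw [hD₂', hM', KT, t₁₂, Kt, Kt, ay, tz']
    have s5 : D₃ᵀ *ᵥ (M *ᵥ osc₂₃) = 0 := by
      rw [hD₃', hM', KT, t₂₃, Kt, Kt, az, tz'']
    have s6 : D₃ᵀ *ᵥ (M *ᵥ osc₁₃) = 0 := by
      rw [hD₃', hM', KT, t₁₃, Kt, Kt, az, tz'']
    rw [cz]
    simp only [Matrix.mulVec_smul, dotProduct_smul, sub_dotProduct, hadj _ _ _ s1, hadj _ _ _ s2,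
      hadj _ _ _ s3, hadj _ _ _ s4, hadj _ _ _ s5, hadj _ _ _ s6, sub_zero, smul_zero, add_zero]
  have hdisj : Disjoint (LinearMap.range curl) O := by
    rw [Submodule.disjoint_def]
    intro x hx hxO
    have h := horth x hx x hxO
    have hnn : ∀ y, 0 ≤ y ⬝ᵥ M *ᵥ y := by
      intro y
      simpa using hMpd.posSemidef.dotProduct_mulVec_nonneg y
    have hz : ∀ y, y ⬝ᵥ M *ᵥ y = 0 → y = 0 := by
      intro y hy
      by_contra hne
      have := hMpd.dotProduct_mulVec_pos hne
      simp only [star_trivial] at this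
      exact this.ne' hy
    have p1 := hnn x.1
    have p2 := hnn x.2.1
    have p3 := hnn x.2.2
    exact Prod.ext (hz _ (by linarith)) (Prod.ext (hz _ (by linarith)) (hz _ (by linarith)))
  have hV : Module.finrank ℝ (GridFun3 N₁ N₂ N₃) = N₁ * N₂ * N₃ := by
    simp [mul_assoc]
  -- rank of the divergence
  let Q := K Px Py Pz
  have hQ : ∀ v, Q *ᵥ v = (t3 fx fy fz ⬝ᵥ v) • t3 oscx oscy oscz :=
    fun v => k3_vecMulVec _ _ _ _ _ _ v
  have hrange : LinearMap.range div = LinearMap.ker Q.mulVecLin := by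
    apply le_antisymm
    · rintro _ ⟨w, rfl⟩
      rw [LinearMap.mem_ker, dz, Matrix.mulVecLin_apply]
      simp only [hD₁', hD₂', hD₃', Q, Px, Py, Pz, Matrix.mulVec_add, Kmul, x3, y3, z3, K0a, K0b, K0c,
        Matrix.zero_mulVec, add_zero]
    · intro v hv
      rw [LinearMap.mem_ker, Matrix.mulVecLin_apply] at hv
      refine ⟨(K Hx 1 1 *ᵥ v, K Px Hy 1 *ᵥ v, K Px Py Hz *ᵥ v), ?_⟩
      rw [dz]
      simp only [hD₁', hD₂', hD₃', Kmul, mul_one, one_mul]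
      have e3 : K Px Py (Dz * Hz) *ᵥ v = K Px Py 1 *ᵥ v := by
        rw [← z1, ← Kc]
        change _ = _ + Q *ᵥ v
        rw [hv, add_zero]
      rw [e3, add_assoc, Kb, y1, Ka, x1, K1, Matrix.one_mulVec]
  have hQr : Module.finrank ℝ (LinearMap.range Q.mulVecLin) = 1 := by
    have : LinearMap.range Q.mulVecLin = Submodule.span ℝ {t3 oscx oscy oscz} := by
      apply le_antisymm
      · rintro _ ⟨w, rfl⟩
        rw [Matrix.mulVecLin_apply, hQ]
        exact Submodule.smul_mem _ _ (Submodule.mem_span_singleton_self _)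
      · rw [Submodule.span_singleton_le_iff_mem]
        refine ⟨t3 oscx oscy oscz, ?_⟩
        rw [Matrix.mulVecLin_apply, hQ, t3_dot, x5, y5, z5]
        simp
    rw [this, finrank_span_singleton (t3_ne ox oy oz)]
  have hkd : Module.finrank ℝ ↥(LinearMap.ker div) = 2 * (N₁ * N₂ * N₃) + 1 := by
    have h1 := div.finrank_range_add_finrank_ker
    have h2 : 1 + Module.finrank ℝ (LinearMap.range div) = N₁ * N₂ * N₃ := by
      rw [hrange, ← hV, ← hQr]
      exact Q.mulVecLin.finrank_range_add_finrank_ker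
    rw [Module.finrank_prod, Module.finrank_prod, hV] at h1
    omega
  have hO3 : Module.finrank ℝ O = 3 := by
    have hli : LinearIndependent ℝ (![(osc₂₃, 0, 0), (0, osc₁₃, 0), (0, 0, osc₁₂)] :
        Fin 3 → GridFun3 N₁ N₂ N₃ × GridFun3 N₁ N₂ N₃ × GridFun3 N₁ N₂ N₃) := by
      rw [Fintype.linearIndependent_iff]
      intro g hg
      simp [Fin.sum_univ_three, n₂₃, n₁₃, n₁₂] at hg
      intro i
      fin_cases i
      · exact hg.1
      · exact hg.2.1
      · exact hg.2.2
    have := finrank_span_eq_card hli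
    rw [hO]
    rw [range_three] at this
    simpa using this
  refine ⟨hker, hdisj, horth, hkd, ?_⟩
  have := Submodule.finrank_sup_add_finrank_inf_eq (LinearMap.range curl) O
  rw [← hker, hdisj.eq_bot, hkd, hO3, finrank_bot] at this
  omega
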